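/- arXiv:2301.12186 — 10 statements merged into one kernel-verified Lean document; each statement's English description precedes it below -/
import Mathlib

section
/- Let f_M > 0 and let P = (x₀, y₀, z₀) ∈ ℝ³ be a point on the paraboloid boundary, i.e. z₀ = (x₀² + y₀²)/(4 f_M) − f_M. Let n = ∇M|_P / |∇M|_P| be the unit normal at P, where ∇M = (−x₀/(2 f_M), −y₀/(2 f_M), 1), and let v ∈ ℝ³ be any velocity vector. Then the reflected velocity v' = v − 2 (v·n) n satisfies x₀ v'_y − y₀ v'_x = x₀ v_y − y₀ v_x; that is, the reduced angular momentum l_z about the z-axis is conserved under ideal reflection at any point of the paraboloid mirror. -/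
open RealInnerProductSpace

/-- Ideal reflection at any point of the paraboloid mirror
conserves the reduced angular momentum `l_z = x v_y − y v_x` about the z-axis. -/
theorem paraboloid_reflection_conserves_reduced_angular_momentum
    (fM : ℝ) (hfM : 0 < fM)
    (x₀ y₀ z₀ : ℝ)
    (hP : z₀ = (x₀ ^ 2 + y₀ ^ 2) / (4 * fM) - fM)
    (gradM : EuclideanSpace ℝ (Fin 3))
    (hgrad0 : gradM 0 = -(x₀ / (2 * fM)))
    (hgrad1 : gradM 1 = -(y₀ / (2 * fM)))
    (hgrad2 : gradM 2 = 1)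
    (n : EuclideanSpace ℝ (Fin 3))
    (hn : n = (1 / ‖gradM‖) • gradM)
    (v v' : EuclideanSpace ℝ (Fin 3))
    (hv' : v' = v - (2 * ⟪v, n⟫) • n) :
    x₀ * v' 1 - y₀ * v' 0 = x₀ * v 1 - y₀ * v 0 := by
  have hn0 : n 0 = 1 / ‖gradM‖ * -(x₀ / (2 * fM)) := by
    rw [hn, PiLp.smul_apply, smul_eq_mul, hgrad0]
  have hn1 : n 1 = 1 / ‖gradM‖ * -(y₀ / (2 * fM)) := by
    rw [hn, PiLp.smul_apply, smul_eq_mul, hgrad1]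
  rw [hv']
  simp only [PiLp.sub_apply, PiLp.smul_apply, smul_eq_mul, hn0, hn1]
  ring
end

section
/- Let f_M > 0, g > 0, and let P = (x₀, y₀, z₀) ∈ ℝ³ lie on the paraboloid boundary, i.e. z₀ = (x₀² + y₀²)/(4 f_M) − f_M. Let v ∈ ℝ³, set H = |v|²/(2g) + z₀, let n = ∇M|_P / |∇M|_P| with ∇M = (−x₀/(2 f_M), −y₀/(2 f_M), 1), and let v' = v − 2 (v·n) n be the reflected velocity. For a velocity w ∈ ℝ³ at P, the focus of the associated flight parabola is Foc(w) = (x₀ + (w_z/g) w_x, y₀ + (w_z/g) w_y, 2 z₀ − H + w_z²/g). Then |Foc(v')| = |Foc(v)|; that is, the foci of the incoming and outgoing flight parabolas lie on a common sphere centered at the origin (the focus of the paraboloid). -/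
open RealInnerProductSpace

/-- The foci of the incoming and outgoing flight parabolas at a
reflection point of the paraboloid mirror lie on a common sphere centered at
the origin (the focus of the paraboloid): `|Foc(v')| = |Foc(v)|`. -/
theorem foci_on_common_sphere
    (fM g : ℝ) (hfM : 0 < fM) (hg : 0 < g)
    (x₀ y₀ z₀ : ℝ)
    (hP : z₀ = (x₀ ^ 2 + y₀ ^ 2) / (4 * fM) - fM)
    (v : EuclideanSpace ℝ (Fin 3))
    (H : ℝ) (hH : H = ‖v‖ ^ 2 / (2 * g) + z₀)
    (gradM : EuclideanSpace ℝ (Fin 3))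
    (hgrad0 : gradM 0 = -(x₀ / (2 * fM)))
    (hgrad1 : gradM 1 = -(y₀ / (2 * fM)))
    (hgrad2 : gradM 2 = 1)
    (n : EuclideanSpace ℝ (Fin 3))
    (hn : n = (1 / ‖gradM‖) • gradM)
    (v' : EuclideanSpace ℝ (Fin 3))
    (hv' : v' = v - (2 * ⟪v, n⟫) • n)
    (Foc : EuclideanSpace ℝ (Fin 3) → EuclideanSpace ℝ (Fin 3))
    (hFoc : ∀ w : EuclideanSpace ℝ (Fin 3),
      Foc w 0 = x₀ + (w 2 / g) * w 0 ∧
      Foc w 1 = y₀ + (w 2 / g) * w 1 ∧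
      Foc w 2 = 2 * z₀ - H + (w 2) ^ 2 / g) :
    ‖Foc v'‖ = ‖Foc v‖ := by
  have hN : 0 < ‖gradM‖ := by
    rw [norm_pos_iff]
    rintro rfl
    simp at hgrad2
  obtain ⟨c, hv'c, hc⟩ : ∃ c : ℝ, v' = v - c • gradM ∧ c * ‖gradM‖ ^ 2 = 2 * ⟪v, gradM⟫ := by
    refine ⟨2 * ⟪v, gradM⟫ / ‖gradM‖ ^ 2, ?_, by field_simp⟩
    rw [hv', hn, inner_smul_right, smul_smul]
    congr 2
    field_simp
  obtain ⟨a, rfl⟩ : ∃ a, x₀ = 2 * fM * a := ⟨x₀ / (2 * fM), by field_simp⟩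
  obtain ⟨b, rfl⟩ : ∃ b, y₀ = 2 * fM * b := ⟨y₀ / (2 * fM), by field_simp⟩
  have hfM' : fM ≠ 0 := hfM.ne'
  have hz : z₀ = fM * (a ^ 2 + b ^ 2 - 1) := by rw [hP]; field_simp; ring
  rw [mul_div_cancel_left₀ _ (by positivity)] at hgrad0 hgrad1
  simp only [EuclideanSpace.real_norm_sq_eq, PiLp.inner_apply, Fin.sum_univ_three, hgrad0, hgrad1,
    hgrad2, RCLike.inner_apply, conj_trivial] at hc hH
  have hv2 : v 2 = c * (1 + a ^ 2 + b ^ 2) / 2 + a * v 0 + b * v 1 := by linarith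
  rw [← sq_eq_sq₀ (norm_nonneg _) (norm_nonneg _)]
  simp only [EuclideanSpace.real_norm_sq_eq, Fin.sum_univ_three, hFoc, hv'c, PiLp.sub_apply,
    PiLp.smul_apply, smul_eq_mul, hgrad0, hgrad1, hgrad2, hH, hz, hv2]
  field_simp
  ring
end

section
/- Let f_M > 0, g > 0, r₀ > 0 and ϑ ∈ [0, π]. Set z₀ = r₀²/(4 f_M) − f_M and define v_r = −(r₀/(2 f_M))·√(g f_M (1 − cos ϑ)), v_φ = (r₀/(2 f_M))·√(g f_M (1 + cos ϑ)), v_z = √(g f_M (1 − cos ϑ)). Consider the ballistic trajectory starting at P₀ = (r₀, 0, z₀) with initial velocity (v_r, v_φ, v_z): r(t) = (r₀ + v_r t, v_φ t, z₀ + v_z t − g t²/2). Then at the flight time T = 2 v_z / g the particle is at the point P₁ = (r₀ cos ϑ, r₀ sin ϑ, z₀); in particular P₁ lies on the paraboloid boundary on the same horizontal circle of radius r₀ as P₀, rotated by the angle ϑ. -/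
/-- The flight parabola starting at `P₀ = (r₀, 0, z₀)` on the
paraboloid with velocity `(v_r, v_φ, v_z)` given by the circle-orbit formulas
reaches, after the flight time `T = 2 v_z / g`, the point
`P₁ = (r₀ cos ϑ, r₀ sin ϑ, z₀)`, which lies on the paraboloid boundary on the
same horizontal circle of radius `r₀`, rotated by the angle `ϑ`. -/
theorem circle_orbit_reflection_point
    (fM g r₀ ϑ : ℝ) (hfM : 0 < fM) (hg : 0 < g) (hr₀ : 0 < r₀)
    (hϑ : ϑ ∈ Set.Icc 0 Real.pi)
    (z₀ vr vφ vz T : ℝ)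
    (hz₀ : z₀ = r₀ ^ 2 / (4 * fM) - fM)
    (hvr : vr = -(r₀ / (2 * fM)) * Real.sqrt (g * fM * (1 - Real.cos ϑ)))
    (hvφ : vφ = (r₀ / (2 * fM)) * Real.sqrt (g * fM * (1 + Real.cos ϑ)))
    (hvz : vz = Real.sqrt (g * fM * (1 - Real.cos ϑ)))
    (hT : T = 2 * vz / g) :
    r₀ + vr * T = r₀ * Real.cos ϑ ∧
    vφ * T = r₀ * Real.sin ϑ ∧
    z₀ + vz * T - g * T ^ 2 / 2 = z₀ ∧
    z₀ = ((r₀ * Real.cos ϑ) ^ 2 + (r₀ * Real.sin ϑ) ^ 2) / (4 * fM) - fM := by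
  have hcos_le := Real.cos_le_one ϑ
  have hgf : 0 < g * fM := mul_pos hg hfM
  have hsq : √(g * fM * (1 - Real.cos ϑ)) ^ 2 = g * fM * (1 - Real.cos ϑ) :=
    Real.sq_sqrt (mul_nonneg hgf.le (by linarith))
  have hprod : √(g * fM * (1 + Real.cos ϑ)) * √(g * fM * (1 - Real.cos ϑ)) =
      g * fM * Real.sin ϑ := by
    rw [mul_comm, ← Real.sqrt_mul (mul_nonneg hgf.le (by linarith)),
      show g * fM * (1 - Real.cos ϑ) * (g * fM * (1 + Real.cos ϑ)) =
        (g * fM * Real.sin ϑ) ^ 2 by rw [mul_pow _ (Real.sin ϑ), Real.sin_sq]; ring]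
    exact Real.sqrt_sq (mul_nonneg hgf.le (Real.sin_nonneg_of_mem_Icc hϑ))
  rw [← hvz] at hvr hsq hprod
  generalize √(g * fM * (1 + Real.cos ϑ)) = w at hvφ hprod
  subst hvr hvφ hT
  refine ⟨?_, ?_, ?_, ?_⟩
  · field_simp
    linear_combination -hsq
  · field_simp
    linear_combination hprod
  · field_simp
    ring
  · rw [hz₀, mul_pow, mul_pow, ← mul_add, Real.cos_sq_add_sin_sq, mul_one]
end

section
/- Let f_M > 0, g > 0, r₀ > 0 and ϑ ∈ [0, π]. Set z₀ = r₀²/(4 f_M) − f_M, v_r = −(r₀/(2 f_M))·√(g f_M (1 − cos ϑ)), v_φ = (r₀/(2 f_M))·√(g f_M (1 + cos ϑ)), v_z = √(g f_M (1 − cos ϑ)), and let r(t) = (r₀ + v_r t, v_φ t, z₀ + v_z t − g t²/2) be the flight trajectory with flight time T = 2 v_z/g. Writing ρ(t) = √(x(t)² + y(t)²), then for every t ∈ [0, T]: (i) the trajectory lies on the rotational surface z = r₀²/(4 f_M) − f_M ρ²/r₀², i.e. z(t) = r₀²/(4 f_M) − f_M ρ(t)²/r₀², and (ii) ρ(t)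 ∈ [r₀ cos(ϑ/2), r₀]. -/
/-- The circle-orbit flight parabola lies, for all flight times
`t ∈ [0, T]`, on the rotational surface `z = r₀²/(4 f_M) − f_M ρ²/r₀²`, and the
radial distance `ρ(t)` stays in the interval `[r₀ cos(ϑ/2), r₀]`. -/
theorem circle_orbit_on_rotational_surface
    (fM g r₀ ϑ : ℝ) (hfM : 0 < fM) (hg : 0 < g) (hr₀ : 0 < r₀)
    (hϑ : ϑ ∈ Set.Icc 0 Real.pi)
    (z₀ vr vφ vz T : ℝ)
    (hz₀ : z₀ = r₀ ^ 2 / (4 * fM) - fM)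
    (hvr : vr = -(r₀ / (2 * fM)) * Real.sqrt (g * fM * (1 - Real.cos ϑ)))
    (hvφ : vφ = (r₀ / (2 * fM)) * Real.sqrt (g * fM * (1 + Real.cos ϑ)))
    (hvz : vz = Real.sqrt (g * fM * (1 - Real.cos ϑ)))
    (hT : T = 2 * vz / g)
    (x y z ρ : ℝ → ℝ)
    (hx : ∀ t, x t = r₀ + vr * t)
    (hy : ∀ t, y t = vφ * t)
    (hz : ∀ t, z t = z₀ + vz * t - g * t ^ 2 / 2)
    (hρ : ∀ t, ρ t = Real.sqrt (x t ^ 2 + y t ^ 2)) :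
    ∀ t ∈ Set.Icc 0 T,
      z t = r₀ ^ 2 / (4 * fM) - fM * (ρ t) ^ 2 / r₀ ^ 2 ∧
      ρ t ∈ Set.Icc (r₀ * Real.cos (ϑ / 2)) r₀ := by
  rintro t ⟨ht0, htT⟩
  have hs1 : vz ^ 2 = g * fM * (1 - Real.cos ϑ) := by
    rw [hvz, Real.sq_sqrt]
    exact mul_nonneg (by positivity) (by linarith [Real.cos_le_one ϑ])
  have hs2 : vφ ^ 2 = (r₀ / (2 * fM)) ^ 2 * (g * fM * (1 + Real.cos ϑ)) := by
    rw [hvφ, mul_pow, Real.sq_sqrt]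
    exact mul_nonneg (by positivity) (by linarith [Real.neg_one_le_cos ϑ])
  rw [← hvz] at hvr
  have hsum : x t ^ 2 + y t ^ 2 = r₀ ^ 2 * (1 - vz * t / fM + g * t ^ 2 / (2 * fM)) := by
    calc x t ^ 2 + y t ^ 2 = r₀ ^ 2 + 2 * r₀ * vr * t + (vr ^ 2 + vφ ^ 2) * t ^ 2 := by
          rw [hx, hy]; ring
      _ = _ := by
          rw [hs2, hvr, mul_pow, hs1]
          field_simp
          ring
  have hρsq : ρ t ^ 2 = r₀ ^ 2 * (1 - vz * t / fM + g * t ^ 2 / (2 * fM)) := by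
    rw [hρ, Real.sq_sqrt (by positivity), hsum]
  have hgt : g * t ≤ 2 * vz := by
    rwa [hT, le_div_iff₀ hg, mul_comm] at htT
  refine ⟨?_, ?_, ?_⟩
  · rw [hz, hρsq, hz₀]
    field_simp
    ring
  · rw [hρ]
    apply Real.le_sqrt_of_sq_le
    have hdiff : x t ^ 2 + y t ^ 2 - (r₀ * Real.cos (ϑ / 2)) ^ 2
        = r₀ ^ 2 / (2 * g * fM) * (g * t - vz) ^ 2 := by
      rw [hsum, mul_pow, Real.cos_sq, mul_div_cancel₀ ϑ two_ne_zero, sub_sq, hs1]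
      field_simp
      ring
    have : 0 ≤ r₀ ^ 2 / (2 * g * fM) * (g * t - vz) ^ 2 := by positivity
    linarith
  · rw [hρ]
    apply Real.sqrt_le_iff.mpr ⟨hr₀.le, ?_⟩
    have hdiff : r₀ ^ 2 - (x t ^ 2 + y t ^ 2)
        = r₀ ^ 2 / (2 * fM) * (t * (2 * vz - g * t)) := by
      rw [hsum]
      field_simp
      ring
    have : 0 ≤ r₀ ^ 2 / (2 * fM) * (t * (2 * vz - g * t)) :=
      mul_nonneg (by positivity) (mul_nonneg ht0 (by linarith))
    linarith
end

section
/- Let g > 0, R > 0, H ∈ ℝ, l_z ≥ 0 and ϑ ∈ (0, π) with H − R cos ϑ > 0 and g R² sin²ϑ (H − R cos ϑ) ≥ l_z². Consider the flight parabola X(t) = (R sin ϑ + t·a, t·l_z/(R sin ϑ), −g t²/2 + (H + R cos ϑ)/2) where a = √(g(H − R cos ϑ) − l_z²/(R² sin²ϑ)), and write ρ(t) = √(X₁(t)² + X₂(t)²). Then for every t ∈ ℝ with ρ(t)² · g(H − R cos ϑ) ≥ l_z², the height of the particle equals one of the two height functions: X₃(t) = h₊(ρ(t), ϑ) or X₃(t)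 = h₋(ρ(t), ϑ), where h_±(r, ϑ) = (H + R cos ϑ)/2 − (g/2)·((√(r² g(H − R cos ϑ) − l_z²) ± √(R² sin²ϑ · g(H − R cos ϑ) − l_z²)) / (g(H − R cos ϑ)))². -/
/-- For the planar motion `t ↦ (S + t a, t l / S)` of squared speed `K = a² + l² / S²`, the radial
distance `r` satisfies `r² K - l² = (S a + t K)²`. -/
lemma radial_sq_mul_speed_sq_sub_sq {S a l K : ℝ} (hS : S ≠ 0) (haK : a ^ 2 = K - l ^ 2 / S ^ 2)
    (t : ℝ) :
    ((S + t * a) ^ 2 + (t * l / S) ^ 2) * K - l ^ 2 = (S * a + t * K) ^ 2 := by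
  obtain rfl : K = a ^ 2 + l ^ 2 / S ^ 2 := by linarith
  field_simp
  ring

/-- Along the flight parabola `X(t)` of the one-parameter family
at fixed `(H, R, l_z)` and focus polar angle `ϑ`, whenever
`ρ(t)² · g(H − R cos ϑ) ≥ l_z²` the height `X₃(t)` equals one of the two
height functions `h₊(ρ(t), ϑ)` or `h₋(ρ(t), ϑ)`. -/
theorem flight_parabola_height_functions
    (g R H lz ϑ : ℝ) (hg : 0 < g) (hR : 0 < R) (hlz : 0 ≤ lz)
    (hϑ : ϑ ∈ Set.Ioo 0 Real.pi)
    (hD : 0 < H - R * Real.cos ϑ)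
    (hJ : lz ^ 2 ≤ g * R ^ 2 * Real.sin ϑ ^ 2 * (H - R * Real.cos ϑ))
    (a : ℝ)
    (ha : a = Real.sqrt (g * (H - R * Real.cos ϑ) - lz ^ 2 / (R ^ 2 * Real.sin ϑ ^ 2)))
    (X₁ X₂ X₃ ρ : ℝ → ℝ)
    (hX₁ : ∀ t, X₁ t = R * Real.sin ϑ + t * a)
    (hX₂ : ∀ t, X₂ t = t * lz / (R * Real.sin ϑ))
    (hX₃ : ∀ t, X₃ t = -g * t ^ 2 / 2 + (H + R * Real.cos ϑ) / 2)
    (hρ : ∀ t, ρ t = Real.sqrt (X₁ t ^ 2 + X₂ t ^ 2))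
    (hplus hminus : ℝ → ℝ)
    (hhp : ∀ r, hplus r = (H + R * Real.cos ϑ) / 2 -
      g / 2 * ((Real.sqrt (r ^ 2 * (g * (H - R * Real.cos ϑ)) - lz ^ 2) +
        Real.sqrt (R ^ 2 * Real.sin ϑ ^ 2 * (g * (H - R * Real.cos ϑ)) - lz ^ 2)) /
        (g * (H - R * Real.cos ϑ))) ^ 2)
    (hhm : ∀ r, hminus r = (H + R * Real.cos ϑ) / 2 -
      g / 2 * ((Real.sqrt (r ^ 2 * (g * (H - R * Real.cos ϑ)) - lz ^ 2) -
        Real.sqrt (R ^ 2 * Real.sin ϑ ^ 2 * (g * (H - R * Real.cos ϑ)) - lz ^ 2)) /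
        (g * (H - R * Real.cos ϑ))) ^ 2) :
    ∀ t : ℝ, lz ^ 2 ≤ ρ t ^ 2 * (g * (H - R * Real.cos ϑ)) →
      X₃ t = hplus (ρ t) ∨ X₃ t = hminus (ρ t) := by
  intro t _
  have hS : 0 < R * Real.sin ϑ := mul_pos hR (Real.sin_pos_of_mem_Ioo hϑ)
  have hK : 0 < g * (H - R * Real.cos ϑ) := mul_pos hg hD
  rw [hhp, hhm, hX₃, hρ, Real.sq_sqrt (by positivity), hX₁, hX₂]
  rw [← mul_pow] at ha ⊢
  have hJ' : lz ^ 2 ≤ g * (H - R * Real.cos ϑ) * (R * Real.sin ϑ) ^ 2 := by linarith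
  generalize R * Real.sin ϑ = S at *
  generalize g * (H - R * Real.cos ϑ) = K at *
  have ha0 : 0 ≤ a := ha ▸ Real.sqrt_nonneg _
  have haK : a ^ 2 = K - lz ^ 2 / S ^ 2 := by
    rw [ha, Real.sq_sqrt]
    rw [sub_nonneg, div_le_iff₀ (by positivity)]
    exact hJ'
  have hSa : S ^ 2 * K - lz ^ 2 = (S * a) ^ 2 := by
    rw [mul_pow, haK]
    field_simp
  rw [radial_sq_mul_speed_sq_sub_sq hS.ne' haK, hSa, Real.sqrt_sq_eq_abs (S * a),
    abs_of_nonneg (mul_nonneg hS.le ha0), Real.sqrt_sq_eq_abs]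
  rcases le_total 0 (S * a + t * K) with h | h
  · right
    rw [abs_of_nonneg h]
    field_simp
    ring
  · left
    rw [abs_of_nonpos h]
    field_simp
    ring
end

section
/- Let g > 0, R > 0, H ∈ ℝ, l_z ≥ 0 and ϑ ∈ (0, π) with H − R cos ϑ > 0 and g R² sin²ϑ (H − R cos ϑ) ≥ l_z². Consider the flight parabola X(t) = (R sin ϑ + t·a, t·l_z/(R sin ϑ), −g t²/2 + (H + R cos ϑ)/2) with a = √(g(H − R cos ϑ) − l_z²/(R² sin²ϑ)). Then for every t ∈ ℝ the squared horizontal distance from the z-axis satisfies X₁(t)² + X₂(t)² ≥ l_z²/(g(H − R cos ϑ)); that is, the radial distance along the trajectory is bounded below by r_min = l_z/√(g(H − R cos ϑ)), and this bound is attained at the time minimizing the horizontal distance. -/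
/-- Along the flight parabola `X(t)` of the one-parameter family
at fixed `(H, R, l_z)` and focus polar angle `ϑ`, the squared horizontal
distance from the z-axis is bounded below by `l_z²/(g(H − R cos ϑ))`, i.e. the
radial distance is at least `r_min = l_z/√(g(H − R cos ϑ))`, and this bound is
attained at the time minimizing the horizontal distance. -/
theorem flight_parabola_radial_lower_bound
    (g R H lz ϑ : ℝ) (hg : 0 < g) (hR : 0 < R) (hlz : 0 ≤ lz)
    (hϑ : ϑ ∈ Set.Ioo 0 Real.pi)
    (hD : 0 < H - R * Real.cos ϑ)
    (hJ : lz ^ 2 ≤ g * R ^ 2 * Real.sin ϑ ^ 2 * (H - R * Real.cos ϑ))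
    (a : ℝ)
    (ha : a = Real.sqrt (g * (H - R * Real.cos ϑ) - lz ^ 2 / (R ^ 2 * Real.sin ϑ ^ 2)))
    (X₁ X₂ X₃ : ℝ → ℝ)
    (hX₁ : ∀ t, X₁ t = R * Real.sin ϑ + t * a)
    (hX₂ : ∀ t, X₂ t = t * lz / (R * Real.sin ϑ))
    (hX₃ : ∀ t, X₃ t = -g * t ^ 2 / 2 + (H + R * Real.cos ϑ) / 2) :
    (∀ t : ℝ, lz ^ 2 / (g * (H - R * Real.cos ϑ)) ≤ X₁ t ^ 2 + X₂ t ^ 2) ∧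
    (∃ t : ℝ, X₁ t ^ 2 + X₂ t ^ 2 = lz ^ 2 / (g * (H - R * Real.cos ϑ))) := by
  have hs : 0 < R * Real.sin ϑ := mul_pos hR (Real.sin_pos_of_mem_Ioo hϑ)
  have hE : 0 < g * (H - R * Real.cos ϑ) := mul_pos hg hD
  have ha_sq : a ^ 2 = g * (H - R * Real.cos ϑ) - lz ^ 2 / (R * Real.sin ϑ) ^ 2 := by
    rw [ha, Real.sq_sqrt, mul_pow]
    rw [sub_nonneg, ← mul_pow, div_le_iff₀ (pow_pos hs 2)]
    linarith
  have key : ∀ t, X₁ t ^ 2 + X₂ t ^ 2 = lz ^ 2 / (g * (H - R * Real.cos ϑ)) +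
      g * (H - R * Real.cos ϑ) *
        (t + R * Real.sin ϑ * a / (g * (H - R * Real.cos ϑ))) ^ 2 := by
    intro t
    rw [hX₁, hX₂]
    generalize R * Real.sin ϑ = s at *
    generalize g * (H - R * Real.cos ϑ) = E at *
    have hlz_sq : lz ^ 2 = (E - a ^ 2) * s ^ 2 := by
      rw [ha_sq]
      field_simp
      ring
    rw [div_pow, mul_pow, hlz_sq]
    field_simp
    ring
  refine ⟨fun t => ?_, -(R * Real.sin ϑ * a / (g * (H - R * Real.cos ϑ))), ?_⟩
  · rw [key]
    exact le_add_of_nonneg_right (by positivity)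
  · rw [key]
    simp
end

section
/- Let g > 0, R > 0 and H ≥ 0, and define J(H, R, ϑ) = g R² sin²ϑ (H − R cos ϑ). Let c_max = (H − √(H² + 3R²))/(3R). Then c_max ∈ [−1, 0], and for every ϑ ∈ [0, π] one has J(H, R, ϑ) ≤ (2/27)·g·(√(H² + 3R²) + 2H)·(H(√(H² + 3R²) − H) + 3R²), with equality exactly when cos ϑ = c_max. In particular the maximal admissible squared reduced angular momentum l_z² at given (H, R) equals this value. -/
/-- The function `J(H, R, ϑ) = g R² sin²ϑ (H − R cos ϑ)` attains,
over `ϑ ∈ [0, π]`, its maximal value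
`(2/27) g (√(H² + 3R²) + 2H) (H(√(H² + 3R²) − H) + 3R²)` exactly when
`cos ϑ = (H − √(H² + 3R²))/(3R) ∈ [−1, 0]`; this value is the maximal
admissible squared reduced angular momentum `l_z²` at given `(H, R)`. -/
theorem max_admissible_squared_angular_momentum
    (g R H : ℝ) (hg : 0 < g) (hR : 0 < R) (hH : 0 ≤ H)
    (J : ℝ → ℝ)
    (hJ : ∀ ϑ, J ϑ = g * R ^ 2 * Real.sin ϑ ^ 2 * (H - R * Real.cos ϑ))
    (cmax Jmax : ℝ)
    (hcmax : cmax = (H - Real.sqrt (H ^ 2 + 3 * R ^ 2)) / (3 * R))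
    (hJmax : Jmax = 2 / 27 * g * (Real.sqrt (H ^ 2 + 3 * R ^ 2) + 2 * H) *
      (H * (Real.sqrt (H ^ 2 + 3 * R ^ 2) - H) + 3 * R ^ 2)) :
    cmax ∈ Set.Icc (-1 : ℝ) 0 ∧
    ∀ ϑ ∈ Set.Icc (0 : ℝ) Real.pi,
      J ϑ ≤ Jmax ∧ (J ϑ = Jmax ↔ Real.cos ϑ = cmax) := by
  set s := Real.sqrt (H ^ 2 + 3 * R ^ 2)
  have hs2 : s ^ 2 = H ^ 2 + 3 * R ^ 2 := Real.sq_sqrt (by positivity)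
  have hs0 : 0 ≤ s := Real.sqrt_nonneg _
  have hHs : H ≤ s := by nlinarith [sq_nonneg R]
  have hsR : s ≤ H + 3 * R := by nlinarith [mul_nonneg hH hR.le]
  have h2s : 3 * R < 2 * s := by nlinarith [sq_nonneg H, mul_pos hR hR]
  have hc : 3 * R * cmax = H - s := by rw [hcmax]; field_simp
  refine ⟨⟨by nlinarith, by nlinarith⟩, fun ϑ _ ↦ ?_⟩
  set c := Real.cos ϑ with hcos
  have hc1 : c ≤ 1 := Real.cos_le_one ϑ
  have gap : Jmax - J ϑ = g / 27 * (3 * R * c - 3 * R * cmax) ^ 2 * (H + 2 * s - 3 * R * c) := by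
    rw [hJmax, hJ, Real.sin_sq, ← hcos, hc]
    linear_combination (g / 27 * (-2 * s + 5 * H - 9 * R * c)) * hs2
  have hpos : 0 < H + 2 * s - 3 * R * c := by nlinarith
  refine ⟨?_, fun h ↦ ?_, fun h ↦ ?_⟩
  · have : 0 ≤ Jmax - J ϑ := by rw [gap]; positivity
    linarith
  · have h0 : g / 27 * (3 * R * c - 3 * R * cmax) ^ 2 * (H + 2 * s - 3 * R * c) = 0 := by
      rw [← gap, h, sub_self]
    have hsq : 3 * R * c - 3 * R * cmax = 0 := by
      simpa [hg.ne', hpos.ne'] using h0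
    exact mul_left_cancel₀ (by positivity : 3 * R ≠ 0) (sub_eq_zero.mp hsq)
  · rw [h, sub_self] at gap
    linarith
end

section
/- Let H > R > 0 and ϑ ∈ (0, π), and for ε ∈ {+1, −1} define h_ε(r, ϑ) = (H + R cos ϑ)/2 − (r + ε R sin ϑ)²/(2(H − R cos ϑ)) for r ≥ 0, and c₊(r) = (H + R)/2 − r²/(2(H + R)). Then for every r ≥ 0 and both signs ε one has h_ε(r, ϑ) ≤ c₊(r), and equality holds for ε = −1 at the tangency radius r = sin ϑ · (H + R)/(1 + cos ϑ). Hence c₊ is the upper envelope of the family of flight parabolas with zero reduced angular momentum. -/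
/-- The gap between `c₊` and a flight parabola is a perfect square up to a positive factor. -/
theorem envelope_sub_parabola_eq_sq {H R s c ε : ℝ} (r : ℝ) (hs : s ^ 2 + c ^ 2 = 1)
    (hε : ε ^ 2 = 1) (hA : H + R ≠ 0) (hB : H - R * c ≠ 0) (hc : 1 + c ≠ 0) :
    ((H + R) / 2 - r ^ 2 / (2 * (H + R))) -
        ((H + R * c) / 2 - (r + ε * (R * s)) ^ 2 / (2 * (H - R * c))) =
      R * (s * (H + R) + ε * ((1 + c) * r)) ^ 2 /
        (2 * (H + R) * (H - R * c) * (1 + c)) := by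
  have hs' : s ^ 2 = 1 - c ^ 2 := by linarith
  rw [add_sq, add_sq, mul_pow ε, mul_pow ε, hε, mul_pow R, mul_pow s, hs']
  field_simp
  ring


/-- For `H > R > 0` the curve `c₊(r) = (H + R)/2 − r²/(2(H + R))`
is the upper envelope of the family of zero-angular-momentum flight parabolas
`h_ε(r, ϑ) = (H + R cos ϑ)/2 − (r + ε R sin ϑ)²/(2(H − R cos ϑ))`: every member
lies below `c₊`, with tangency for `ε = −1` at `r = sin ϑ (H + R)/(1 + cos ϑ)`. -/
theorem upper_envelope_zero_angular_momentum
    (H R : ℝ) (hR : 0 < R) (hHR : R < H)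
    (ϑ : ℝ) (hϑ : ϑ ∈ Set.Ioo 0 Real.pi)
    (h : ℝ → ℝ → ℝ)
    (hh : ∀ ε r, h ε r = (H + R * Real.cos ϑ) / 2 -
      (r + ε * (R * Real.sin ϑ)) ^ 2 / (2 * (H - R * Real.cos ϑ)))
    (cplus : ℝ → ℝ)
    (hc : ∀ r, cplus r = (H + R) / 2 - r ^ 2 / (2 * (H + R))) :
    (∀ r ≥ (0 : ℝ), ∀ ε ∈ ({1, -1} : Set ℝ), h ε r ≤ cplus r) ∧
    h (-1) (Real.sin ϑ * (H + R) / (1 + Real.cos ϑ)) =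
      cplus (Real.sin ϑ * (H + R) / (1 + Real.cos ϑ)) := by
  have hcos : 0 < 1 + Real.cos ϑ := by
    have := Real.cos_lt_cos_of_nonneg_of_le_pi hϑ.1.le le_rfl hϑ.2
    rw [Real.cos_pi] at this
    linarith
  have hA : 0 < H + R := by linarith
  have hB : 0 < H - R * Real.cos ϑ := by nlinarith [Real.cos_le_one ϑ]
  have gap (ε r : ℝ) (hε : ε ^ 2 = 1) :=
    envelope_sub_parabola_eq_sq r (Real.sin_sq_add_cos_sq ϑ) hε hA.ne' hB.ne' hcos.ne'
  refine ⟨fun r _ ε hε => ?_, ?_⟩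
  · have hε' : ε ^ 2 = 1 := by
      rcases hε with rfl | rfl <;> norm_num
    rw [hh, hc, ← sub_nonneg, gap ε r hε']
    positivity
  · rw [hh, hc, eq_comm, ← sub_eq_zero, gap _ _ (by norm_num), mul_div_cancel₀ _ hcos.ne']
    simp
end

section
/- Let H > R > 0 and ϑ ∈ (0, π), and for ε ∈ {+1, −1} define h_ε(r, ϑ) = (H + R cos ϑ)/2 − (r + ε R sin ϑ)²/(2(H − R cos ϑ)) for r ≥ 0, and c₋(r) = (H − R)/2 − r²/(2(H − R)). Then for every r ≥ 0 and both signs ε one has h_ε(r, ϑ) ≥ c₋(r), and equality holds for ε = +1 at the tangency radius r = sin ϑ · (H − R)/(1 − cos ϑ). Hence c₋ is the lower envelope of the family of flight parabolas with zero reduced angular momentum. -/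
/-- The gap between a flight parabola, written with `c = cos ϑ` and `s = sin ϑ`, and the curve
`c₋` is a perfect square up to a positive factor. -/
theorem flight_parabola_sub_lower_envelope {H R c s ε : ℝ} (r : ℝ) (hA : H - R ≠ 0)
    (hB : H - R * c ≠ 0) (hc : 1 - c ≠ 0) (hs : s ^ 2 + c ^ 2 = 1) (hε : ε ^ 2 = 1) :
    (H + R * c) / 2 - (r + ε * (R * s)) ^ 2 / (2 * (H - R * c)) -
        ((H - R) / 2 - r ^ 2 / (2 * (H - R))) =
      R * (s * (H - R) - ε * (1 - c) * r) ^ 2 /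
        (2 * (H - R) * (H - R * c) * (1 - c)) := by
  have hs' : s ^ 2 = 1 - c ^ 2 := by linarith
  field_simp
  ring_nf
  simp only [hε, hs']
  ring

/-- For `H > R > 0` the curve `c₋(r) = (H − R)/2 − r²/(2(H − R))`
is the lower envelope of the family of zero-angular-momentum flight parabolas
`h_ε(r, ϑ) = (H + R cos ϑ)/2 − (r + ε R sin ϑ)²/(2(H − R cos ϑ))`: every member
lies above `c₋`, with tangency for `ε = +1` at `r = sin ϑ (H − R)/(1 − cos ϑ)`. -/
theorem lower_envelope_zero_angular_momentum
    (H R : ℝ) (hR : 0 < R) (hHR : R < H)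
    (ϑ : ℝ) (hϑ : ϑ ∈ Set.Ioo 0 Real.pi)
    (h : ℝ → ℝ → ℝ)
    (hh : ∀ ε r, h ε r = (H + R * Real.cos ϑ) / 2 -
      (r + ε * (R * Real.sin ϑ)) ^ 2 / (2 * (H - R * Real.cos ϑ)))
    (cminus : ℝ → ℝ)
    (hc : ∀ r, cminus r = (H - R) / 2 - r ^ 2 / (2 * (H - R))) :
    (∀ r ≥ (0 : ℝ), ∀ ε ∈ ({1, -1} : Set ℝ), cminus r ≤ h ε r) ∧
    h 1 (Real.sin ϑ * (H - R) / (1 - Real.cos ϑ)) =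
      cminus (Real.sin ϑ * (H - R) / (1 - Real.cos ϑ)) := by
  have hcos : Real.cos ϑ < 1 := by
    simpa using Real.cos_lt_cos_of_nonneg_of_le_pi le_rfl hϑ.2.le hϑ.1
  have hA : 0 < H - R := sub_pos.2 hHR
  have hc1 : 0 < 1 - Real.cos ϑ := sub_pos.2 hcos
  have hB : 0 < H - R * Real.cos ϑ := by nlinarith
  have gap (r ε : ℝ) (hε : ε ^ 2 = 1) :=
    flight_parabola_sub_lower_envelope r hA.ne' hB.ne' hc1.ne' (Real.sin_sq_add_cos_sq ϑ) hε
  refine ⟨fun r _ ε hε => ?_, ?_⟩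
  · have hε' : ε ^ 2 = 1 := by
      rcases hε with rfl | rfl <;> norm_num
    rw [← sub_nonneg, hh, hc, gap r ε hε']
    positivity
  · rw [← sub_eq_zero, hh, hc, gap _ 1 (one_pow 2), one_mul, mul_div_cancel₀ _ hc1.ne']
    simp
end

section
/- Let g > 0, R > 0, H ∈ ℝ, l_z ≥ 0 and ϑ ∈ (0, π) with H − R cos ϑ > 0 and g R² sin²ϑ (H − R cos ϑ) ≥ l_z². Consider the flight parabola X(t) = (R sin ϑ + t·a, t·l_z/(R sin ϑ), −g t²/2 + (H + R cos ϑ)/2) with a = √(g(H − R cos ϑ) − l_z²/(R² sin²ϑ)). Its vertex is S = X(0) = (R sin ϑ, 0, (H + R cos ϑ)/2), its focal length is F = (H − R cos ϑ)/2, and its focus S − F e_z = (R sin ϑ, 0, R cos ϑ) lies at distance exactly R from the origin; that is, the focus of every such flight parabola lies on the sphere of radius R centered at the focus of the paraboloid. -/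
/-- The flight parabola `X(t)` of the one-parameter family at
fixed `(H, R, l_z)` and focus polar angle `ϑ` has vertex
`S = X(0) = (R sin ϑ, 0, (H + R cos ϑ)/2)`, focal length `F = (H − R cos ϑ)/2`,
and focus `S − F e_z = (R sin ϑ, 0, R cos ϑ)` lying at distance exactly `R`
from the origin (the focus of the paraboloid). -/
theorem flight_parabola_focus_on_sphere
    (g R H lz ϑ : ℝ) (hg : 0 < g) (hR : 0 < R) (hlz : 0 ≤ lz)
    (hϑ : ϑ ∈ Set.Ioo 0 Real.pi)
    (hD : 0 < H - R * Real.cos ϑ)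
    (hJ : lz ^ 2 ≤ g * R ^ 2 * Real.sin ϑ ^ 2 * (H - R * Real.cos ϑ))
    (a : ℝ)
    (ha : a = Real.sqrt (g * (H - R * Real.cos ϑ) - lz ^ 2 / (R ^ 2 * Real.sin ϑ ^ 2)))
    (X₁ X₂ X₃ : ℝ → ℝ)
    (hX₁ : ∀ t, X₁ t = R * Real.sin ϑ + t * a)
    (hX₂ : ∀ t, X₂ t = t * lz / (R * Real.sin ϑ))
    (hX₃ : ∀ t, X₃ t = -g * t ^ 2 / 2 + (H + R * Real.cos ϑ) / 2)
    (F : ℝ) (hF : F = (a ^ 2 + (lz / (R * Real.sin ϑ)) ^ 2) / (2 * g)) :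
    X₁ 0 = R * Real.sin ϑ ∧ X₂ 0 = 0 ∧ X₃ 0 = (H + R * Real.cos ϑ) / 2 ∧
    F = (H - R * Real.cos ϑ) / 2 ∧
    X₁ 0 = R * Real.sin ϑ ∧ X₃ 0 - F = R * Real.cos ϑ ∧
    Real.sqrt ((X₁ 0) ^ 2 + (X₂ 0) ^ 2 + (X₃ 0 - F) ^ 2) = R := by
  have hs : 0 < Real.sin ϑ := Real.sin_pos_of_mem_Ioo hϑ
  have hnonneg : 0 ≤ g * (H - R * Real.cos ϑ) - lz ^ 2 / (R ^ 2 * Real.sin ϑ ^ 2) := by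
    rw [sub_nonneg, div_le_iff₀ (by positivity)]
    linarith
  have hFval : F = (H - R * Real.cos ϑ) / 2 := by
    rw [hF, ha, Real.sq_sqrt hnonneg]
    field_simp
    ring
  have h₁ : X₁ 0 = R * Real.sin ϑ := by simp [hX₁]
  have h₂ : X₂ 0 = 0 := by simp [hX₂]
  have h₃ : X₃ 0 = (H + R * Real.cos ϑ) / 2 := by simp [hX₃]
  have hfocus : X₃ 0 - F = R * Real.cos ϑ := by
    rw [h₃, hFval]
    ring
  refine ⟨h₁, h₂, h₃, hFval, h₁, hfocus, ?_⟩
  rw [h₁, h₂, hfocus, Real.sqrt_eq_iff_mul_self_eq (by positivity) hR.le]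
  linear_combination R ^ 2 * Real.sin_sq_add_cos_sq ϑ
end
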